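/- Let k ≥ 2 be an integer, γ > 0 and s real numbers, and φ ∈ 𝓜. Define μ(ξ) = (1+|ξ'|²+|ξ_k|^{2γ})^{s/2}·φ((1+|ξ'|²+|ξ_k|^{2γ})^{1/2}) for ξ = (ξ', ξ_k) ∈ ℝ^{k−1} × ℝ. Then there exist constants c > 0 and l > 0 such that μ(ξ)/μ(η) ≤ c·(1+|ξ−η|)^l for all ξ, η ∈ ℝ^k. -/

import Mathlib

open Filter

open MeasureTheory in
/-- The uniform convergence theorem for slowly varying functions, in additive form: a measurable
function whose increments over each fixed step vanish at infinity has uniformly bounded increments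
over steps in `[0, 1]`. -/
theorem exists_forall_abs_increment_le_one {h : ℝ → ℝ} (hm : Measurable h)
    (hs : ∀ u : ℝ, Tendsto (fun x => h (x + u) - h x) atTop (nhds 0)) :
    ∃ X : ℝ, ∀ x, X ≤ x → ∀ u ∈ Set.Icc (0 : ℝ) 1, |h (x + u) - h x| ≤ 1 := by
  by_contra! hcon
  choose x hx u hu hxu using fun n : ℕ => hcon n
  have hx_top : Tendsto x atTop atTop := tendsto_atTop_mono hx tendsto_natCast_atTop_atTop
  have hy_top : Tendsto (fun n => x n + u n) atTop atTop :=
    tendsto_atTop_mono (fun n => by linarith [(hu n).1]) hx_top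
  have small : ∀ y : ℕ → ℝ, Tendsto y atTop atTop →
      ∀ᶠ n in atTop, volume.restrict (Set.Icc (0 : ℝ) 2)
        {t | (1 / 2 : ℝ) ≤ |h (y n + t) - h (y n)|} < 1 / 2 := by
    intro y hy
    have hmeas : TendstoInMeasure (volume.restrict (Set.Icc (0 : ℝ) 2))
        (fun n t => h (y n + t) - h (y n)) atTop (fun _ => (0 : ℝ)) :=
      tendstoInMeasure_of_tendsto_ae
        (fun n => ((hm.comp (measurable_const_add _)).sub_const _).aestronglyMeasurable)
        (ae_of_all _ fun t => (hs t).comp hy)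
    have h2 := tendstoInMeasure_iff_norm.1 hmeas (1 / 2) (by norm_num)
    simp only [sub_zero, Real.norm_eq_abs] at h2
    exact h2.eventually (gt_mem_nhds (by simp))
  obtain ⟨n, h1, h2⟩ := ((small x hx_top).and (small _ hy_top)).exists
  have meas : ∀ a : ℝ, MeasurableSet {t | (1 / 2 : ℝ) ≤ |h (a + t) - h a|} := fun a =>
    measurableSet_le measurable_const ((hm.comp (measurable_const_add a)).sub_const _).abs
  rw [Measure.restrict_apply (meas _)] at h1 h2
  have cover : Set.Icc (1 : ℝ) 2 ⊆
      ({t | (1 / 2 : ℝ) ≤ |h (x n + t) - h (x n)|} ∩ Set.Icc 0 2) ∪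
      (fun t => t + -u n) ⁻¹'
        ({t | (1 / 2 : ℝ) ≤ |h (x n + u n + t) - h (x n + u n)|} ∩ Set.Icc 0 2) := by
    intro t ht
    obtain ⟨ht1, ht2⟩ := ht
    obtain ⟨hu0, hu1⟩ := hu n
    by_contra hnot
    simp only [Set.mem_union, Set.mem_inter_iff, Set.mem_ofPred_eq, Set.mem_Icc, Set.mem_preimage,
      not_or, not_and] at hnot
    obtain ⟨n1, n2⟩ := hnot
    have k1 : |h (x n + t) - h (x n)| < 1 / 2 := by
      by_contra! hc
      exact n1 hc (by linarith) ht2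
    have k2 : |h (x n + u n + (t + -u n)) - h (x n + u n)| < 1 / 2 := by
      by_contra! hc
      exact n2 hc (by linarith) (by linarith)
    rw [show x n + u n + (t + -u n) = x n + t by ring] at k2
    have k3 := hxu n
    rw [abs_lt] at k1 k2
    rw [lt_abs] at k3
    rcases k3 with k3 | k3 <;> linarith [k1.1, k1.2, k2.1, k2.2]
  have hle := (measure_mono (μ := volume) cover).trans (measure_union_le _ _)
  rw [measure_preimage_add_right, Real.volume_Icc] at hle
  have hlt := hle.trans_lt (ENNReal.add_lt_add h1 h2)
  rw [ENNReal.add_halves] at hlt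
  norm_num at hlt

/-- Uniformly bounded increments over steps in `[0, 1]` give at most linear growth of increments. -/
theorem abs_sub_le_mul_one_add_abs_sub {h : ℝ → ℝ} {M : ℝ}
    (hM : ∀ x, 0 ≤ x → ∀ u ∈ Set.Icc (0 : ℝ) 1, |h (x + u) - h x| ≤ M)
    {x y : ℝ} (hx : 0 ≤ x) (hy : 0 ≤ y) : |h x - h y| ≤ M * (1 + |x - y|) := by
  have hM0 : 0 ≤ M := (abs_nonneg _).trans (hM 0 le_rfl 0 (by simp))
  have steps : ∀ n : ℕ, ∀ x, 0 ≤ x → ∀ u : ℝ, 0 ≤ u → u ≤ n → |h (x + u) - h x| ≤ M * n := by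
    intro n
    induction n with
    | zero =>
      intro x _ u hu0 hu
      obtain rfl : u = 0 := le_antisymm (by simpa using hu) hu0
      simp
    | succ n ih =>
      intro x hx u hu0 hu
      push_cast at hu ⊢
      rcases le_total u 1 with h1 | h1
      · have := hM x hx u ⟨hu0, h1⟩
        nlinarith [mul_nonneg hM0 (Nat.cast_nonneg (α := ℝ) n)]
      · have h2 := ih (x + 1) (by linarith) (u - 1) (by linarith) (by linarith)
        have h3 := hM x hx 1 (by simp)
        rw [show x + 1 + (u - 1) = x + u by ring] at h2
        linarith [abs_sub_le (h (x + u)) (h (x + 1)) (h x)]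
  have incr : ∀ x, 0 ≤ x → ∀ u, 0 ≤ u → |h (x + u) - h x| ≤ M * (1 + u) := fun x hx u hu =>
    (steps ⌈u⌉₊ x hx u hu (Nat.le_ceil u)).trans
      (mul_le_mul_of_nonneg_left (by linarith [Nat.ceil_lt_add_one hu]) hM0)
  rcases le_total y x with hxy | hxy
  · rw [abs_of_nonneg (sub_nonneg.2 hxy)]
    simpa using incr y hy (x - y) (sub_nonneg.2 hxy)
  · rw [abs_sub_comm, abs_sub_comm x, abs_of_nonneg (sub_nonneg.2 hxy)]
    simpa using incr x hx (y - x) (sub_nonneg.2 hxy)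

/-- A Potter-type bound: the logarithm of a slowly varying function, in the logarithmic variable,
has increments of at most linear growth. -/
theorem exists_abs_log_sub_le_of_slowlyVarying {φ : ℝ → ℝ} (hφmeas : Measurable φ)
    (hφpos : ∀ r : ℝ, 1 ≤ r → 0 < φ r)
    (hφbd : ∀ d : ℝ, 1 < d → ∃ C : ℝ, ∀ r : ℝ, 1 ≤ r → r ≤ d → φ r ≤ C ∧ (φ r)⁻¹ ≤ C)
    (hφslow : ∀ l : ℝ, 0 < l → Tendsto (fun r : ℝ => φ (l * r) / φ r) atTop (nhds 1)) :
    ∃ A : ℝ, 0 ≤ A ∧ ∀ x y : ℝ, 0 ≤ x → 0 ≤ y →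
      |Real.log (φ (Real.exp x)) - Real.log (φ (Real.exp y))| ≤ A * (1 + |x - y|) := by
  set h : ℝ → ℝ := fun x => Real.log (φ (Real.exp x)) with hh
  have hm : Measurable h := Real.measurable_log.comp (hφmeas.comp Real.measurable_exp)
  have hs : ∀ u : ℝ, Tendsto (fun x => h (x + u) - h x) atTop (nhds 0) := by
    intro u
    have h1 := ((hφslow _ (Real.exp_pos u)).comp Real.tendsto_exp_atTop).log one_ne_zero
    rw [Real.log_one] at h1
    refine h1.congr' ?_
    filter_upwards [eventually_ge_atTop 0, eventually_ge_atTop (-u)] with x hx0 hxu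
    have e1 := hφpos (Real.exp x) (Real.one_le_exp hx0)
    have e2 := hφpos (Real.exp (x + u)) (Real.one_le_exp (by linarith))
    simp only [hh, Function.comp_apply, ← Real.exp_add, add_comm u x]
    exact Real.log_div e2.ne' e1.ne'
  obtain ⟨X, hX⟩ := exists_forall_abs_increment_le_one hm hs
  obtain ⟨C, hC⟩ := hφbd (Real.exp (|X| + 1)) (Real.one_lt_exp_iff.2 (by positivity))
  have bound : ∀ x, 0 ≤ x → x ≤ |X| + 1 → |h x| ≤ Real.log C := by
    intro x hx0 hx
    have e0 := hφpos (Real.exp x) (Real.one_le_exp hx0)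
    obtain ⟨c1, c2⟩ := hC (Real.exp x) (Real.one_le_exp hx0) (Real.exp_le_exp.2 hx)
    have l1 := Real.log_le_log e0 c1
    have l2 := Real.log_le_log (inv_pos.2 e0) c2
    rw [Real.log_inv] at l2
    exact abs_le.2 ⟨by linarith, l1⟩
  have hM : ∀ x, 0 ≤ x → ∀ u ∈ Set.Icc (0 : ℝ) 1,
      |h (x + u) - h x| ≤ max 1 (2 * Real.log C) := by
    rintro x hx u ⟨hu0, hu1⟩
    rcases le_total X x with hXx | hXx
    · exact (hX x hXx u ⟨hu0, hu1⟩).trans (le_max_left _ _)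
    · refine le_trans ?_ (le_max_right _ _)
      have hXa := le_abs_self X
      linarith [abs_sub (h (x + u)) (h x), bound x hx (by linarith),
        bound (x + u) (by linarith) (by linarith)]
  exact ⟨max 1 (2 * Real.log C), by positivity, fun x y hx hy =>
    abs_sub_le_mul_one_add_abs_sub hM hx hy⟩

/-- The anisotropic quantity `1 + |ξ'|² + |ξ_k|^{2γ}` is temperate. -/
theorem one_add_sq_add_rpow_le {E : Type*} [SeminormedAddCommGroup E] {γ : ℝ} (hγ : 0 < γ)
    (ξ η : E × ℝ) :
    1 + ‖ξ.1‖ ^ 2 + |ξ.2| ^ (2 * γ) ≤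
      3 * (1 + Real.sqrt (‖ξ.1 - η.1‖ ^ 2 + (ξ.2 - η.2) ^ 2)) ^ (2 + 2 * γ) *
        (1 + ‖η.1‖ ^ 2 + |η.2| ^ (2 * γ)) := by
  set d := Real.sqrt (‖ξ.1 - η.1‖ ^ 2 + (ξ.2 - η.2) ^ 2)
  set p := 1 + ‖η.1‖ ^ 2 + |η.2| ^ (2 * γ) with hp
  have hd0 : 0 ≤ d := Real.sqrt_nonneg _
  have hd1 : ‖ξ.1 - η.1‖ ≤ d := Real.le_sqrt_of_sq_le (by nlinarith [sq_nonneg (ξ.2 - η.2)])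
  have hd2 : |ξ.2 - η.2| ≤ d :=
    Real.le_sqrt_of_sq_le (by rw [sq_abs]; nlinarith [sq_nonneg ‖ξ.1 - η.1‖])
  have hq : 0 ≤ |η.2| ^ (2 * γ) := by positivity
  have hp1 : 1 ≤ p := by nlinarith [sq_nonneg ‖η.1‖]
  have hp0 : 0 ≤ p := by linarith
  have key : ∀ a b e : ℝ, 0 ≤ a → 0 ≤ b → 0 < e → e ≤ 2 + 2 * γ → a ≤ b + d → b ^ e ≤ p →
      a ^ e ≤ (1 + d) ^ (2 + 2 * γ) * p := by
    intro a b e ha hb he hle hab hbp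
    have h1 : a ≤ (1 + d) * max 1 b := by
      nlinarith [le_max_left 1 b, le_max_right 1 b,
        mul_le_mul_of_nonneg_left (le_max_left 1 b) hd0]
    have h2 : (max 1 b) ^ e ≤ p := by
      rcases max_choice 1 b with h | h <;> rw [h]
      · simpa using hp1
      · exact hbp
    calc a ^ e ≤ ((1 + d) * max 1 b) ^ e := Real.rpow_le_rpow ha h1 he.le
      _ = (1 + d) ^ e * (max 1 b) ^ e := Real.mul_rpow (by linarith) (by positivity)
      _ ≤ (1 + d) ^ (2 + 2 * γ) * p :=
        mul_le_mul (Real.rpow_le_rpow_of_exponent_le (by linarith) hle) h2 (by positivity)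
          (by positivity)
  have k1 := key ‖ξ.1‖ ‖η.1‖ 2 (norm_nonneg _) (norm_nonneg _) two_pos (by linarith)
    (by linarith [norm_le_insert' ξ.1 η.1]) (by rw [Real.rpow_two]; linarith)
  rw [Real.rpow_two] at k1
  have k2 := key |ξ.2| |η.2| (2 * γ) (abs_nonneg _) (abs_nonneg _) (by linarith) (by linarith)
    (by linarith [abs_sub_abs_le_abs_sub ξ.2 η.2]) (by linarith [sq_nonneg ‖η.1‖])
  have k3 := key 1 1 2 zero_le_one zero_le_one two_pos (by linarith) (by linarith) (by simpa)
  rw [Real.one_rpow] at k3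
  linarith

/-- Hörmander's temperateness condition for the anisotropic weight `μ`. -/
theorem anisotropic_weight_temperate
    (k : ℕ) (hk : 2 ≤ k) (γ : ℝ) (hγ : 0 < γ) (s : ℝ)
    (φ : ℝ → ℝ) (hφmeas : Measurable φ)
    (hφpos : ∀ r : ℝ, 1 ≤ r → 0 < φ r)
    (hφbd : ∀ d : ℝ, 1 < d → ∃ C : ℝ, ∀ r : ℝ, 1 ≤ r → r ≤ d → φ r ≤ C ∧ (φ r)⁻¹ ≤ C)
    (hφslow : ∀ l : ℝ, 0 < l →
      Tendsto (fun r : ℝ => φ (l * r) / φ r) atTop (nhds 1))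
    (μ : EuclideanSpace ℝ (Fin (k - 1)) × ℝ → ℝ)
    (hμ : ∀ ξ, μ ξ = (1 + ‖ξ.1‖ ^ 2 + |ξ.2| ^ (2 * γ)) ^ (s / 2) *
        φ ((1 + ‖ξ.1‖ ^ 2 + |ξ.2| ^ (2 * γ)) ^ ((1 : ℝ) / 2))) :
    ∃ c l : ℝ, 0 < c ∧ 0 < l ∧
      ∀ ξ η : EuclideanSpace ℝ (Fin (k - 1)) × ℝ,
        μ ξ / μ η ≤ c * (1 + Real.sqrt (‖ξ.1 - η.1‖ ^ 2 + (ξ.2 - η.2) ^ 2)) ^ l := by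
  obtain ⟨A, hA0, hA⟩ := exists_abs_log_sub_le_of_slowlyVarying hφmeas hφpos hφbd hφslow
  set p : EuclideanSpace ℝ (Fin (k - 1)) × ℝ → ℝ :=
    fun ξ => 1 + ‖ξ.1‖ ^ 2 + |ξ.2| ^ (2 * γ) with hp
  have hp1 : ∀ ξ, 1 ≤ p ξ := fun ξ => by
    have : 0 ≤ |ξ.2| ^ (2 * γ) := by positivity
    simp only [hp]
    nlinarith [sq_nonneg ‖ξ.1‖]
  have hp0 : ∀ ξ, 0 < p ξ := fun ξ => one_pos.trans_le (hp1 ξ)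
  have hφp : ∀ ξ, 0 < φ (p ξ ^ ((1 : ℝ) / 2)) := fun ξ =>
    hφpos _ (Real.one_le_rpow (hp1 ξ) (by norm_num))
  have hμpos : ∀ ξ, 0 < μ ξ := fun ξ => by
    rw [hμ]
    exact mul_pos (Real.rpow_pos_of_pos (hp0 ξ) _) (hφp ξ)
  have hlogμ : ∀ ξ, Real.log (μ ξ) =
      s / 2 * Real.log (p ξ) + Real.log (φ (Real.exp (Real.log (p ξ) / 2))) := fun ξ => by
    rw [hμ, Real.log_mul (Real.rpow_pos_of_pos (hp0 ξ) _).ne' (hφp ξ).ne',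
      Real.log_rpow (hp0 ξ), ← mul_one_div (Real.log (p ξ)), ← Real.rpow_def_of_pos (hp0 ξ)]
  have hlogp : ∀ ξ η, Real.log (p ξ) - Real.log (p η) ≤ Real.log 3 + (2 + 2 * γ) *
      Real.log (1 + Real.sqrt (‖ξ.1 - η.1‖ ^ 2 + (ξ.2 - η.2) ^ 2)) := fun ξ η => by
    have hd : 0 < 1 + Real.sqrt (‖ξ.1 - η.1‖ ^ 2 + (ξ.2 - η.2) ^ 2) := by positivity
    have h := Real.log_le_log (hp0 ξ) (one_add_sq_add_rpow_le hγ ξ η)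
    rw [Real.log_mul (by positivity) (hp0 η).ne', Real.log_mul (by norm_num) (by positivity),
      Real.log_rpow hd] at h
    linarith
  set B := (A + |s|) / 2 with hB
  have hB0 : 0 ≤ B := by positivity
  refine ⟨Real.exp (A + B * Real.log 3), B * (2 + 2 * γ) + 1, Real.exp_pos _, by positivity,
    fun ξ η => ?_⟩
  have h12 := hlogp ξ η
  have h21 := hlogp η ξ
  rw [norm_sub_rev, ← neg_sub ξ.2, neg_sq] at h21
  set d := Real.sqrt (‖ξ.1 - η.1‖ ^ 2 + (ξ.2 - η.2) ^ 2)
  have hd0 : 0 ≤ d := Real.sqrt_nonneg _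
  have hL : 0 ≤ Real.log (1 + d) := Real.log_nonneg (by linarith)
  have habs : |Real.log (p ξ) - Real.log (p η)| ≤
      Real.log 3 + (2 + 2 * γ) * Real.log (1 + d) := abs_le.2 ⟨by linarith, h12⟩
  have hφd := (le_abs_self _).trans (hA (Real.log (p ξ) / 2) (Real.log (p η) / 2)
    (div_nonneg (Real.log_nonneg (hp1 ξ)) two_pos.le)
    (div_nonneg (Real.log_nonneg (hp1 η)) two_pos.le))
  rw [← sub_div, abs_div, abs_two] at hφd
  have hsd : s * (Real.log (p ξ) - Real.log (p η)) ≤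
      |s| * |Real.log (p ξ) - Real.log (p η)| := (le_abs_self _).trans (abs_mul _ _).le
  have hlog : Real.log (μ ξ / μ η) ≤
      (A + B * Real.log 3) + Real.log (1 + d) * (B * (2 + 2 * γ) + 1) := by
    rw [Real.log_div (hμpos ξ).ne' (hμpos η).ne', hlogμ, hlogμ]
    have := mul_le_mul_of_nonneg_left habs hB0
    rw [hB] at this ⊢
    linarith
  rw [Real.rpow_def_of_pos (by linarith), ← Real.exp_add]
  exact (Real.log_le_iff_le_exp (div_pos (hμpos ξ) (hμpos η))).1 hlog
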